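/- There exists an absolute constant c₁ > 0 such that for all y ≥ 2 and all s = σ+iτ, w = κ+it with σ, κ > 0 satisfying |σ − κ| ≤ c₁σ and max{σ + |τ|, κ + |t|} ≤ c₁/log y, one has Re(f_y(s,w) − f_y(σ,κ)) ≤ −c₁ (y/log y) ( log(1 + (τ/σ)²) + log(1 + (t/κ)²) ). -/

import Mathlib

open Complex Finset MeasureTheory
open scoped Real Classical

noncomputable section

/-- The set of primes `p ≤ y`. -/
def primesLe (y : ℝ) : Finset ℕ := (Finset.Iic ⌊y⌋₊).filter Nat.Prime

/-- `α` satisfies the saddle-point equation `∑_{p ≤ y} log p/(p^α − 1) = log x`. -/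
def saddleEq (x y α : ℝ) : Prop :=
  ∑ p ∈ primesLe y, Real.log p / ((p : ℝ) ^ α - 1) = Real.log x

/-- `ū = min{u, π(y)}` where `u = log x/log y`. -/
def ubar (x y : ℝ) : ℝ := min (Real.log x / Real.log y) ((primesLe y).card)

def sigma2 (y α : ℝ) : ℝ :=
  ∑ p ∈ primesLe y, (Real.log p) ^ 2 * (p : ℝ) ^ α / ((p : ℝ) ^ α - 1) ^ 2

def sigma2t (y α : ℝ) : ℝ :=
  ∑ p ∈ primesLe y, (Real.log p) ^ 2 / ((p : ℝ) ^ α - 1) ^ 2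

/-- `ϱ = (1/2)(σ₂ − σ̃₂/3)^{1/2}`. -/
def rhoXY (y α : ℝ) : ℝ := (1 / 2) * Real.sqrt (sigma2 y α - sigma2t y α / 3)

/-- `n` is `y`-friable: every prime factor of `n` is at most `y`. -/
def friable (y : ℝ) (n : ℕ) : Prop := ∀ p : ℕ, p.Prime → p ∣ n → (p : ℝ) ≤ y

/-- `S(x,y)`: the set of `y`-friable integers `1 ≤ n ≤ x`. -/
def Sxy (x y : ℝ) : Finset ℕ := (Finset.Icc 1 ⌊x⌋₊).filter (friable y)

/-- `Ψ(x,y) = #S(x,y)`. -/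
def Psi (x y : ℝ) : ℕ := (Sxy x y).card

/-- `D(x,y;γ) = Ψ(x,y)⁻¹ ∑_{n ∈ S(x,y)} τ(n)⁻¹ #{d ∣ n : d ≥ √n e^γ}`. -/
def Dxy (x y γ : ℝ) : ℝ :=
  (Psi x y : ℝ)⁻¹ * ∑ n ∈ Sxy x y,
    ((n.divisors.card : ℝ))⁻¹ *
      ((n.divisors.filter (fun d => Real.sqrt n * Real.exp γ ≤ (d : ℝ))).card : ℝ)

/-- `Φ(v) = ∫_v^∞ e^{-z²/2} dz/√(2π)`. -/
def PhiGauss (v : ℝ) : ℝ :=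
  ∫ z in Set.Ioi v, Real.exp (-z ^ 2 / 2) / Real.sqrt (2 * Real.pi)

/-- `g(z) = log((z^{1/2} − z^{-1/2})/log z)`, with `g(1) = 0`. -/
def gfun (z : ℂ) : ℂ :=
  if z = 1 then 0
  else Complex.log ((z ^ (2⁻¹ : ℂ) - z ^ (-2⁻¹ : ℂ)) / Complex.log z)

/-- `Ξ(a,b) = −(1/2)log(1−a) − (1/2)log(1−b) − g((1−a)/(1−b))`. -/
def Xi (a b : ℂ) : ℂ :=
  -(2⁻¹ : ℂ) * Complex.log (1 - a) - (2⁻¹ : ℂ) * Complex.log (1 - b) -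
    gfun ((1 - a) / (1 - b))

/-- `f_y(s,w) = ∑_{p ≤ y} Ξ(p^{-s}, p^{-w})`. -/
def fy (y : ℝ) (s w : ℂ) : ℂ := ∑ p ∈ primesLe y, Xi ((p : ℂ) ^ (-s)) ((p : ℂ) ^ (-w))

/-- `F_y(s,w) = exp(f_y(s,w))`. -/
def Fy (y : ℝ) (s w : ℂ) : ℂ := Complex.exp (fy y s w)

/-- `F_y(σ,κ)` at real arguments, as a (positive) real number. -/
def FyR (y σ κ : ℝ) : ℝ := Real.exp ((fy y (σ : ℂ) (κ : ℂ)).re)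

/-- `∂_{kℓ}f(s,w)`: partial derivative `k` times in the first variable and `ℓ` times
in the second. -/
def pdv (k l : ℕ) (f : ℂ → ℂ → ℂ) (s w : ℂ) : ℂ :=
  iteratedDeriv k (fun z => iteratedDeriv l (f z) w) s

/-- `Hess[f_y] = (∂₂₀f_y)(∂₀₂f_y) − (∂₁₁f_y)²`. -/
def HessC (y : ℝ) (s w : ℂ) : ℂ :=
  pdv 2 0 (fy y) s w * pdv 0 2 (fy y) s w - (pdv 1 1 (fy y) s w) ^ 2

/-- The domain `D_δ(α;y)`. -/
def Ddom (δ α y : ℝ) : Set (ℝ × ℝ) :=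
  {p | 0 < p.1 ∧ p.1 ≤ 1 ∧ 0 < p.2 ∧ p.2 ≤ 1 ∧ 0 ≤ (p.1 - α) * (α - p.2) ∧
    1 / (1 + δ) ≤ (1 - (2 : ℝ) ^ (-p.1)) / (1 - (2 : ℝ) ^ (-p.2)) ∧
    (1 - (2 : ℝ) ^ (-p.1)) / (1 - (2 : ℝ) ^ (-p.2)) ≤ 1 + δ ∧
    |p.1 - p.2| * Real.log y ≤ δ}

/-- `φ_k(s,y)`: the `k`-th derivative in `s` of `φ₀(s,y) = −∑_{p ≤ y} log(1−p^{-s})`. -/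
def phiD (y : ℝ) (k : ℕ) (s : ℂ) : ℂ :=
  iteratedDeriv k (fun z => -∑ p ∈ primesLe y, Complex.log (1 - (p : ℂ) ^ (-z))) s

/-- `φ₂(σ,y) = ∑_{p ≤ y} (log p)² p^σ/(p^σ−1)²` for real `σ`. -/
def phi2R (y σ : ℝ) : ℝ :=
  ∑ p ∈ primesLe y, (Real.log p) ^ 2 * (p : ℝ) ^ σ / ((p : ℝ) ^ σ - 1) ^ 2

/-- If `Re A, Re B > 0`, the principal logarithm of the quotient is the difference of logarithms. -/
theorem log_div_of_re_pos {A B : ℂ} (hA : 0 < A.re) (hB : 0 < B.re) :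
    Complex.log (A / B) = Complex.log A - Complex.log B := by
  have hA0 : A ≠ 0 := by rintro rfl; simp at hA
  have hB0 : B ≠ 0 := by rintro rfl; simp at hB
  have h1 := abs_lt.1 (Complex.abs_arg_lt_pi_div_two_iff.2 (Or.inl hA))
  have h2 := abs_lt.1 (Complex.abs_arg_lt_pi_div_two_iff.2 (Or.inl hB))
  rw [← Complex.log_exp (x := Complex.log A - Complex.log B), Complex.exp_sub,
    Complex.exp_log hA0, Complex.exp_log hB0]
  · simp only [Complex.sub_im, Complex.log_im]; linarith
  · simp only [Complex.sub_im, Complex.log_im]; linarith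

theorem one_sub_mul_re_pos {a : ℂ} (ha : ‖a‖ < 1) {v : ℝ} (hv : v ∈ Set.Icc (0 : ℝ) 1) :
    0 < (1 - (v : ℂ) * a).re := by
  have h := (Complex.abs_re_le_norm a).trans_lt ha
  simp only [Complex.sub_re, Complex.one_re, Complex.re_ofReal_mul]
  nlinarith [abs_lt.1 h, hv.1, hv.2]

theorem one_sub_mul_ne_zero {a : ℂ} (ha : ‖a‖ < 1) {v : ℝ} (hv : v ∈ Set.Icc (0 : ℝ) 1) :
    1 - (v : ℂ) * a ≠ 0 := by
  intro h
  have := one_sub_mul_re_pos ha hv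
  simp [h] at this

theorem continuousOn_inv_one_sub_mul {a : ℂ} (ha : ‖a‖ < 1) :
    ContinuousOn (fun v : ℝ => (1 - (v : ℂ) * a)⁻¹) (Set.Icc 0 1) :=
  ContinuousOn.inv₀ (by fun_prop) fun _ hv => one_sub_mul_ne_zero ha hv

theorem exp_Xi_eq_div {a b : ℂ} (ha : ‖a‖ < 1) (hb : ‖b‖ < 1) (hab : a ≠ b) :
    Complex.exp (Xi a b) =
      (Complex.log (1 - b) - Complex.log (1 - a)) / (a - b) := by
  have hA : 0 < (1 - a).re := by simpa using one_sub_mul_re_pos ha (v := 1) (by simp)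
  have hB : 0 < (1 - b).re := by simpa using one_sub_mul_re_pos hb (v := 1) (by simp)
  have hA0 : 1 - a ≠ 0 := by intro h; simp [h] at hA
  have hB0 : 1 - b ≠ 0 := by intro h; simp [h] at hB
  have hz1 : (1 - a) / (1 - b) ≠ 1 := by
    intro h
    rw [div_eq_one_iff_eq hB0] at h
    exact hab (by linear_combination -h)
  have hz0 : (1 - a) / (1 - b) ≠ 0 := div_ne_zero hA0 hB0
  have hlog := log_div_of_re_pos hA hB
  have eA := Complex.exp_log hA0
  have eB := Complex.exp_log hB0
  rw [Xi, gfun, if_neg hz1, Complex.cpow_def_of_ne_zero hz0, Complex.cpow_def_of_ne_zero hz0, hlog]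
  generalize Complex.log (1 - a) = x at *
  generalize Complex.log (1 - b) = z at *
  have hexp : a - b = Complex.exp z - Complex.exp x := by rw [eA, eB]; ring
  have hxz : x - z ≠ 0 := by
    intro h
    rw [sub_eq_zero.1 h, sub_self, sub_eq_zero] at hexp
    exact hab hexp
  have hne : Complex.exp x - Complex.exp z ≠ 0 := by
    intro h
    exact hab (by linear_combination hexp - h)
  set X := Complex.exp (x * 2⁻¹) with hX
  set Z := Complex.exp (z * 2⁻¹) with hZ
  have hX0 : X ≠ 0 := Complex.exp_ne_zero _
  have hZ0 : Z ≠ 0 := Complex.exp_ne_zero _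
  have e1 : Complex.exp x = X ^ 2 := by rw [hX, ← Complex.exp_nat_mul]; congr 1; push_cast; ring
  have e2 : Complex.exp z = Z ^ 2 := by rw [hZ, ← Complex.exp_nat_mul]; congr 1; push_cast; ring
  have e3 : Complex.exp ((x - z) * 2⁻¹) = X / Z := by
    rw [hX, hZ, ← Complex.exp_sub]; congr 1; ring
  have e4 : Complex.exp ((x - z) * -2⁻¹) = Z / X := by
    rw [hX, hZ, ← Complex.exp_sub]; congr 1; ring
  have hne' : X ^ 2 - Z ^ 2 ≠ 0 := by rwa [e1, e2] at hne
  have e5 : X / Z - Z / X = (X ^ 2 - Z ^ 2) / (X * Z) := by field_simp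
  rw [e3, e4, Complex.exp_sub, Complex.exp_log, hexp, e1, e2, e5,
    show -(2⁻¹ : ℂ) * x - 2⁻¹ * z = -(x * 2⁻¹) - z * 2⁻¹ by ring, Complex.exp_sub, Complex.exp_neg,
    ← hX, ← hZ]
  · have hne2 : Z ^ 2 - X ^ 2 ≠ 0 := fun h => hne' (by linear_combination -h)
    field_simp
    ring
  · rw [e5]
    exact div_ne_zero (div_ne_zero hne' (mul_ne_zero hX0 hZ0)) hxz

/-- `exp Ξ(a,b) = ∫₀¹ dv / ((1 - va)(1 - vb))`. -/
theorem exp_Xi_eq_integral {a b : ℂ} (ha : ‖a‖ < 1) (hb : ‖b‖ < 1) :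
    Complex.exp (Xi a b) =
      ∫ v in (0 : ℝ)..1, (1 - (v : ℂ) * a)⁻¹ * (1 - (v : ℂ) * b)⁻¹ := by
  have hcont : IntervalIntegrable
      (fun v : ℝ => (1 - (v : ℂ) * a)⁻¹ * (1 - (v : ℂ) * b)⁻¹) volume 0 1 := by
    apply ContinuousOn.intervalIntegrable
    rw [Set.uIcc_of_le zero_le_one]
    exact (continuousOn_inv_one_sub_mul ha).mul (continuousOn_inv_one_sub_mul hb)
  have hd : ∀ c : ℂ, ∀ v : ℝ, HasDerivAt (fun v : ℝ => 1 - (v : ℂ) * c) (-c) v := by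
    intro c v
    simpa using ((Complex.ofRealCLM.hasDerivAt (x := v)).mul_const c).const_sub 1
  by_cases hab : a = b
  · subst hab
    have hA0 : 1 - a ≠ 0 := by simpa using one_sub_mul_ne_zero ha (v := 1) (by simp)
    rw [intervalIntegral.integral_eq_sub_of_hasDerivAt
      (f := fun v : ℝ => (v : ℂ) * (1 - (v : ℂ) * a)⁻¹) ?_ hcont]
    · rw [Xi, gfun, div_self hA0, if_pos rfl,
        show -(2⁻¹ : ℂ) * Complex.log (1 - a) - 2⁻¹ * Complex.log (1 - a) - 0
          = -Complex.log (1 - a) by ring, Complex.exp_neg, Complex.exp_log hA0]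
      simp
    · intro v hv
      rw [Set.uIcc_of_le zero_le_one] at hv
      have h0 := one_sub_mul_ne_zero ha hv
      refine ((Complex.ofRealCLM.hasDerivAt (x := v)).mul ((hd a v).inv h0)).congr_deriv ?_
      simp only [Complex.ofRealCLM_apply, Complex.ofReal_one, Pi.inv_apply]
      field_simp
      ring
  · rw [exp_Xi_eq_div ha hb hab]
    have hs : a - b ≠ 0 := sub_ne_zero.2 hab
    rw [intervalIntegral.integral_eq_sub_of_hasDerivAt
      (f := fun v : ℝ => (Complex.log (1 - (v : ℂ) * b) - Complex.log (1 - (v : ℂ) * a)) / (a - b))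
      ?_ hcont]
    · simp
    · intro v hv
      rw [Set.uIcc_of_le zero_le_one] at hv
      have ha0 := one_sub_mul_ne_zero ha hv
      have hb0 := one_sub_mul_ne_zero hb hv
      refine ((((hd b v).clog_real (Or.inl (one_sub_mul_re_pos hb hv))).sub
        ((hd a v).clog_real (Or.inl (one_sub_mul_re_pos ha hv)))).div_const (a - b)).congr_deriv ?_
      rw [div_sub_div _ _ hb0 ha0, div_div, ← mul_inv, inv_eq_one_div,
        div_eq_div_iff (by positivity) (by positivity)]
      ring

/-- A lower bound for the number of primes up to `y`, of Chebyshev type. -/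
theorem div_log_le_card_primesLe {y : ℝ} (hy : 2 ≤ y) :
    1 / 10 * (y / Real.log y) ≤ (primesLe y).card := by
  have hl : 0 < Real.log y := Real.log_pos (by linarith)
  have hl2 := Real.log_two_gt_d9
  have hl2' := Real.log_two_lt_d9
  rw [← mul_div_assoc, div_le_iff₀ hl]
  rcases le_total y 5 with h5 | h5
  · have h2 : 2 ∈ primesLe y := by
      simp only [primesLe, Finset.mem_filter, Finset.mem_Iic]
      exact ⟨Nat.le_floor (by simpa using hy), Nat.prime_two⟩
    have hc : (1 : ℝ) ≤ (primesLe y).card := by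
      exact_mod_cast Finset.card_pos.2 ⟨2, h2⟩
    have := Real.log_le_log (by norm_num) hy
    nlinarith
  · have hcard : (primesLe y).card = Nat.primeCounting ⌊y⌋₊ := by
      rw [primesLe, Nat.primeCounting, Nat.primeCounting', Nat.count_eq_card_filter_range]
      congr 1
      ext n
      simp
    have h := Chebyshev.pi_ge' (x := y) (by linarith)
    rw [div_le_iff₀ hl, ← hcard] at h
    have h8 : Real.log (y + 2) ≤ (y + 2) / 8 - 1 + 3 * Real.log 2 := by
      have h1 := Real.log_le_sub_one_of_pos (x := (y + 2) / 8) (by linarith)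
      rw [Real.log_div (by linarith) (by norm_num), show (8 : ℝ) = 2 ^ 3 by norm_num,
        Real.log_pow] at h1
      norm_num at h1 ⊢
      linarith
    nlinarith

theorem one_sub_mul_exp_neg_le {x v : ℝ} (hx : 0 ≤ x) (hv : v ∈ Set.Icc (0 : ℝ) 1) :
    1 - v * Real.exp (-x) ≤ 1 - v + x := by
  nlinarith [Real.add_one_le_exp (-x), hv.1, hv.2]

theorem le_one_sub_mul_exp_neg {x v : ℝ} (hx : 0 ≤ x) (hx1 : x ≤ 1 / 2)
    (hv : v ∈ Set.Icc (0 : ℝ) 1) : (1 - v + x) / 4 ≤ 1 - v * Real.exp (-x) := by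
  have h1 : Real.exp (-x) ≤ 1 - x / 2 := by
    rw [Real.exp_neg, inv_le_comm₀ (Real.exp_pos x) (by linarith)]
    refine le_trans ?_ (Real.add_one_le_exp x)
    rw [inv_le_iff_one_le_mul₀ (by linarith)]
    nlinarith
  nlinarith [mul_le_mul_of_nonneg_left h1 hv.1, hv.1, hv.2]

theorem norm_one_sub_mul_sq {a : ℂ} {r θ : ℝ} (hn : ‖a‖ = r) (hre : a.re = r * Real.cos θ) (v : ℝ) :
    ‖1 - (v : ℂ) * a‖ ^ 2 = (1 - v * r) ^ 2 + 2 * v * r * (1 - Real.cos θ) := by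
  have h : a.re ^ 2 + a.im ^ 2 = r ^ 2 := by
    rw [← hn, Complex.sq_norm, Complex.normSq_apply]; ring
  rw [Complex.sq_norm, Complex.normSq_apply]
  simp only [Complex.sub_re, Complex.one_re, Complex.re_ofReal_mul, Complex.sub_im, Complex.one_im,
    Complex.im_ofReal_mul]
  linear_combination v ^ 2 * h - 2 * v * hre

theorem one_sub_mul_norm_le (a : ℂ) {v : ℝ} (hv : 0 ≤ v) :
    1 - v * ‖a‖ ≤ ‖1 - (v : ℂ) * a‖ := by
  have := norm_sub_norm_le (1 : ℂ) ((v : ℂ) * a)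
  simpa [abs_of_nonneg hv] using this

theorem half_abs_le_norm_one_sub_mul {a : ℂ} {r θ : ℝ} (hn : ‖a‖ = r)
    (hre : a.re = r * Real.cos θ) (hθ : |θ| ≤ 1 / 2) (v : ℝ) :
    |θ| / 2 ≤ ‖1 - (v : ℂ) * a‖ := by
  have hs : |θ| / 2 ≤ |Real.sin θ| := by
    have h := Real.mul_abs_le_abs_sin (x := θ) (by linarith [Real.pi_gt_three])
    refine le_trans ?_ h
    rw [div_eq_inv_mul]
    gcongr
    rw [inv_eq_one_div, div_le_div_iff₀ (by norm_num) Real.pi_pos]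
    linarith [Real.pi_le_four]
  refine hs.trans (abs_le_of_sq_le_sq ?_ (norm_nonneg _))
  rw [norm_one_sub_mul_sq hn hre]
  nlinarith [sq_nonneg (v * r - Real.cos θ), Real.sin_sq_add_cos_sq θ]

/-- Data attached to one prime: `a`, `b` have moduli `e^{-l}`, `e^{-m}` with `l`, `m` small and of
the same order, and `θ` is an argument of `a`. -/
structure KernelData (a b : ℂ) (l m θ : ℝ) : Prop where
  l_pos : 0 < l
  l_le : l ≤ 1 / 2
  m_pos : 0 < m
  m_le : m ≤ 1 / 2
  l_le_m : l ≤ 2 * m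
  m_le_l : m ≤ 2 * l
  abs_le : |θ| ≤ 1 / 2
  norm_a : ‖a‖ = Real.exp (-l)
  norm_b : ‖b‖ = Real.exp (-m)
  re_a : a.re = Real.exp (-l) * Real.cos θ

namespace KernelData

variable {a b : ℂ} {l m θ : ℝ}

theorem norm_a_lt (h : KernelData a b l m θ) : ‖a‖ < 1 := by
  rw [h.norm_a, Real.exp_lt_one_iff]; linarith [h.l_pos]

theorem norm_b_lt (h : KernelData a b l m θ) : ‖b‖ < 1 := by
  rw [h.norm_b, Real.exp_lt_one_iff]; linarith [h.m_pos]

theorem weight_le (h : KernelData a b l m θ) {v : ℝ} (hv : v ∈ Set.Icc (0 : ℝ) 1) :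
    (1 - v + l) / 4 ≤ 1 - v * Real.exp (-l) ∧ (1 - v + l) / 8 ≤ 1 - v * Real.exp (-m) := by
  refine ⟨le_one_sub_mul_exp_neg h.l_pos.le h.l_le hv, ?_⟩
  have := le_one_sub_mul_exp_neg h.m_pos.le h.m_le hv
  linarith [h.l_le_m, hv.2]

theorem intervalIntegrable_norm (h : KernelData a b l m θ) : IntervalIntegrable
    (fun v : ℝ => ‖1 - (v : ℂ) * a‖⁻¹ * ‖1 - (v : ℂ) * b‖⁻¹) volume 0 1 := by
  apply ContinuousOn.intervalIntegrable
  rw [Set.uIcc_of_le zero_le_one]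
  refine ContinuousOn.mul (ContinuousOn.inv₀ (by fun_prop) fun v hv => ?_)
    (ContinuousOn.inv₀ (by fun_prop) fun v hv => ?_)
  · exact norm_ne_zero_iff.2 (one_sub_mul_ne_zero h.norm_a_lt hv)
  · exact norm_ne_zero_iff.2 (one_sub_mul_ne_zero h.norm_b_lt hv)

theorem intervalIntegrable_real (h : KernelData a b l m θ) {u v : ℝ}
    (hu : u ∈ Set.Icc (0 : ℝ) 1) (hv : v ∈ Set.Icc (0 : ℝ) 1) : IntervalIntegrable
    (fun v : ℝ => (1 - v * Real.exp (-l))⁻¹ * (1 - v * Real.exp (-m))⁻¹) volume u v := by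
  apply ContinuousOn.intervalIntegrable
  refine ContinuousOn.mono (s := Set.Icc 0 1) ?_ (Set.uIcc_subset_Icc hu hv)
  refine ContinuousOn.mul (ContinuousOn.inv₀ (by fun_prop) fun v hv => ?_)
    (ContinuousOn.inv₀ (by fun_prop) fun v hv => ?_)
  · have := (h.weight_le hv).1
    have := h.l_pos
    linarith [hv.2]
  · have := (h.weight_le hv).2
    have := h.l_pos
    linarith [hv.2]

theorem norm_exp_Xi_le (h : KernelData a b l m θ) :
    Real.exp (Xi a b).re ≤ ∫ v in (0 : ℝ)..1, ‖1 - (v : ℂ) * a‖⁻¹ * ‖1 - (v : ℂ) * b‖⁻¹ := by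
  rw [← Complex.norm_exp, exp_Xi_eq_integral h.norm_a_lt h.norm_b_lt]
  refine (intervalIntegral.norm_integral_le_integral_norm zero_le_one).trans_eq ?_
  simp only [norm_mul, norm_inv]

theorem exp_Xi_real (h : KernelData a b l m θ) :
    Real.exp (Xi (Real.exp (-l) : ℝ) (Real.exp (-m) : ℝ)).re =
      ∫ v in (0 : ℝ)..1, (1 - v * Real.exp (-l))⁻¹ * (1 - v * Real.exp (-m))⁻¹ := by
  have e := exp_Xi_eq_integral (a := (Real.exp (-l) : ℝ)) (b := (Real.exp (-m) : ℝ))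
    (by rw [Complex.norm_real, Real.norm_of_nonneg (Real.exp_pos _).le, ← h.norm_a]
        exact h.norm_a_lt)
    (by rw [Complex.norm_real, Real.norm_of_nonneg (Real.exp_pos _).le, ← h.norm_b]
        exact h.norm_b_lt)
  rw [← Complex.norm_exp, e]
  have e2 : ∀ v : ℝ, (1 - (v : ℂ) * (Real.exp (-l) : ℝ))⁻¹ * (1 - (v : ℂ) * (Real.exp (-m) : ℝ))⁻¹ =
      (((1 - v * Real.exp (-l))⁻¹ * (1 - v * Real.exp (-m))⁻¹ : ℝ) : ℂ) := by
    intro v; push_cast; rfl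
  simp_rw [e2]
  rw [intervalIntegral.integral_ofReal, Complex.norm_real, Real.norm_of_nonneg]
  refine intervalIntegral.integral_nonneg zero_le_one fun v hv => ?_
  have h1 := h.weight_le hv
  have := h.l_pos
  exact mul_nonneg (inv_nonneg.2 (by linarith [hv.2])) (inv_nonneg.2 (by linarith [hv.2]))

theorem le_integrand (h : KernelData a b l m θ) {v : ℝ} (hv : v ∈ Set.Icc (1 - l) 1) :
    1 / (6 * l ^ 2) ≤ (1 - v * Real.exp (-l))⁻¹ * (1 - v * Real.exp (-m))⁻¹ := by
  have hl := h.l_pos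
  have hv' : v ∈ Set.Icc (0 : ℝ) 1 := ⟨by linarith [hv.1, h.l_le], hv.2⟩
  have h1 := h.weight_le hv'
  have h2 := one_sub_mul_exp_neg_le h.l_pos.le hv'
  have h3 := one_sub_mul_exp_neg_le h.m_pos.le hv'
  have p1 : 0 < 1 - v * Real.exp (-l) := by linarith [hv.2]
  have p2 : 0 < 1 - v * Real.exp (-m) := by linarith [hv.2]
  rw [← mul_inv, one_div]
  apply inv_anti₀ (by positivity)
  calc _ ≤ (2 * l) * (3 * l) := by
        gcongr
        · linarith [hv.1]
        · linarith [hv.1, h.m_le_l]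
    _ = 6 * l ^ 2 := by ring

theorem le_integral_real (h : KernelData a b l m θ) : 1 / (6 * l) ≤
    ∫ v in (1 - l)..1, (1 - v * Real.exp (-l))⁻¹ * (1 - v * Real.exp (-m))⁻¹ := by
  have hl := h.l_pos
  have hl' := h.l_le
  have := intervalIntegral.integral_mono_on (a := 1 - l) (b := 1) (by linarith)
    (intervalIntegrable_const (c := 1 / (6 * l ^ 2)) (μ := volume))
    (h.intervalIntegrable_real ⟨by linarith, by linarith⟩ ⟨by simp, le_rfl⟩)
    (fun v hv => h.le_integrand hv)
  refine le_trans (le_of_eq ?_) this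
  rw [intervalIntegral.integral_const, smul_eq_mul]
  field_simp
  ring

theorem integral_split (h : KernelData a b l m θ) :
    (∫ v in (0 : ℝ)..1, (1 - v * Real.exp (-l))⁻¹ * (1 - v * Real.exp (-m))⁻¹) =
    (∫ v in (0 : ℝ)..(1 - l), (1 - v * Real.exp (-l))⁻¹ * (1 - v * Real.exp (-m))⁻¹) +
    ∫ v in (1 - l)..1, (1 - v * Real.exp (-l))⁻¹ * (1 - v * Real.exp (-m))⁻¹ := by
  have hl := h.l_pos
  have hl' := h.l_le
  have h1 : 1 - l ∈ Set.Icc (0 : ℝ) 1 := ⟨by linarith, by linarith⟩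
  exact (intervalIntegral.integral_add_adjacent_intervals
    (h.intervalIntegrable_real ⟨le_rfl, by simp⟩ h1)
    (h.intervalIntegrable_real h1 ⟨by simp, le_rfl⟩)).symm

theorem le_integral_real_zero_one (h : KernelData a b l m θ) : 1 / (6 * l) ≤
    ∫ v in (0 : ℝ)..1, (1 - v * Real.exp (-l))⁻¹ * (1 - v * Real.exp (-m))⁻¹ := by
  have hl := h.l_pos
  have hl' := h.l_le
  rw [h.integral_split]
  refine le_add_of_nonneg_of_le (intervalIntegral.integral_nonneg (by linarith) fun v hv => ?_)
    h.le_integral_real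
  have h1 := h.weight_le ⟨hv.1, by linarith [hv.2]⟩
  exact mul_nonneg (inv_nonneg.2 (by linarith [hv.2])) (inv_nonneg.2 (by linarith [hv.2]))

end KernelData

theorem integral_rpow_one_sub_add_le {l q : ℝ} (hl : 0 < l) (hq : q < -1) :
    (∫ v in (0 : ℝ)..1, (1 - v + l) ^ q) ≤ l ^ (q + 1) / (-(q + 1)) := by
  have e : (∫ v in (0 : ℝ)..1, (1 - v + l) ^ q) = ∫ x in l..(1 + l), x ^ q := by
    have := intervalIntegral.integral_comp_sub_left (a := 0) (b := 1) (fun x : ℝ => x ^ q) (1 + l)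
    rw [sub_zero, add_sub_cancel_left] at this
    rw [← this]
    congr 1; ext v; congr 1; ring
  rw [e, integral_rpow (Or.inr ⟨by linarith, ?_⟩)]
  · rw [div_neg, sub_div, ← neg_div_neg_eq ((1 + l) ^ (q + 1))]
    have : 0 ≤ -(1 + l) ^ (q + 1) / -(q + 1) * -1 := by
      have : 0 < (1 + l) ^ (q + 1) := by positivity
      rw [neg_div, neg_mul_neg, mul_one]
      exact div_nonneg this.le (by linarith)
    linarith
  · rw [Set.uIcc_of_le (by linarith)]
    intro h; linarith [h.1]

theorem intervalIntegrable_rpow_one_sub_add {l q : ℝ} (hl : 0 < l) :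
    IntervalIntegrable (fun v : ℝ => (1 - v + l) ^ q) volume 0 1 := by
  apply ContinuousOn.intervalIntegrable
  rw [Set.uIcc_of_le zero_le_one]
  refine ContinuousOn.rpow_const (by fun_prop) fun v hv => Or.inl ?_
  linarith [hv.2]

namespace KernelData

variable {a b : ℂ} {l m θ : ℝ}

theorem integral_real_le (h : KernelData a b l m θ) :
    (∫ v in (0 : ℝ)..1, (1 - v * Real.exp (-l))⁻¹ * (1 - v * Real.exp (-m))⁻¹) ≤ 32 / l := by
  have hl := h.l_pos
  calc _ ≤ ∫ v in (0 : ℝ)..1, 32 * (1 - v + l) ^ (-2 : ℝ) := by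
        refine intervalIntegral.integral_mono_on zero_le_one
          (h.intervalIntegrable_real ⟨le_rfl, by simp⟩ ⟨by simp, le_rfl⟩)
          ((intervalIntegrable_rpow_one_sub_add hl).const_mul _) fun v hv => ?_
        have hw : 0 < 1 - v + l := by linarith [hv.2]
        have h1 := h.weight_le hv
        calc _ ≤ ((1 - v + l) / 4)⁻¹ * ((1 - v + l) / 8)⁻¹ := by
              gcongr
              · exact inv_nonneg.2 (by linarith [h1.2])
              · exact h1.1
              · exact h1.2
          _ = _ := by
              rw [show (-2 : ℝ) = -(2 : ℕ) by norm_num, Real.rpow_neg hw.le, Real.rpow_natCast]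
              field_simp
              norm_num
    _ ≤ 32 * (l ^ (-2 + 1 : ℝ) / (-(-2 + 1))) := by
        rw [intervalIntegral.integral_const_mul]
        gcongr
        exact integral_rpow_one_sub_add_le hl (by norm_num)
    _ = 32 / l := by
        norm_num [Real.rpow_neg_one]
        rfl

/-- Decay of the ratio when `|θ|/l` is large. -/
theorem exp_re_sub_le_sqrt (h : KernelData a b l m θ) (hθ0 : θ ≠ 0) :
    Real.exp ((Xi a b).re - (Xi (Real.exp (-l) : ℝ) (Real.exp (-m) : ℝ)).re) ≤
      288 * (l / |θ|) ^ (1 / 2 : ℝ) := by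
  have hl := h.l_pos
  have hθ : 0 < |θ| := abs_pos.2 hθ0
  have key : Real.exp (Xi a b).re ≤ 48 * (l * |θ|) ^ (-1 / 2 : ℝ) := by
    refine h.norm_exp_Xi_le.trans ?_
    calc _ ≤ ∫ v in (0 : ℝ)..1, (24 * |θ| ^ (-1 / 2 : ℝ)) * (1 - v + l) ^ (-3 / 2 : ℝ) := by
          refine intervalIntegral.integral_mono_on zero_le_one h.intervalIntegrable_norm
            ((intervalIntegrable_rpow_one_sub_add hl).const_mul _) fun v hv => ?_
          have hw : 0 < 1 - v + l := by linarith [hv.2]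
          have h1 := h.weight_le hv
          have hA := one_sub_mul_norm_le a hv.1
          have hB := one_sub_mul_norm_le b hv.1
          have hA' := half_abs_le_norm_one_sub_mul h.norm_a h.re_a h.abs_le v
          rw [h.norm_a] at hA
          rw [h.norm_b] at hB
          have hsq : ((1 - v + l) * |θ|) ^ (1 / 2 : ℝ) / 3 ≤ ‖1 - (v : ℂ) * a‖ := by
            refine (pow_le_pow_iff_left₀ (by positivity) (norm_nonneg _) two_ne_zero).1 ?_
            rw [div_pow, ← Real.sqrt_eq_rpow, Real.sq_sqrt (by positivity)]
            have : (1 - v + l) / 4 * (|θ| / 2) ≤ ‖1 - (v : ℂ) * a‖ * ‖1 - (v : ℂ) * a‖ := by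
              gcongr
              linarith [h1.1]
            nlinarith [mul_pos hw hθ]
          calc _ ≤ (((1 - v + l) * |θ|) ^ (1 / 2 : ℝ) / 3)⁻¹ * ((1 - v + l) / 8)⁻¹ := by
                gcongr
                linarith [h1.2]
            _ = _ := by
                rw [show (-3 / 2 : ℝ) = -(1 / 2) + -1 by norm_num, Real.rpow_add hw,
                  show (-1 / 2 : ℝ) = -(1 / 2) by norm_num, Real.rpow_neg hw.le,
                  Real.rpow_neg_one, Real.rpow_neg hθ.le, Real.mul_rpow hw.le hθ.le]
                field_simp
                norm_num
      _ ≤ (24 * |θ| ^ (-1 / 2 : ℝ)) * (l ^ (-3 / 2 + 1 : ℝ) / (-(-3 / 2 + 1))) := by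
          rw [intervalIntegral.integral_const_mul]
          gcongr
          exact integral_rpow_one_sub_add_le hl (by norm_num)
      _ = _ := by
          rw [Real.mul_rpow hl.le hθ.le, show (-3 / 2 + 1 : ℝ) = -1 / 2 by norm_num]
          ring
  rw [Real.exp_sub, div_le_iff₀ (Real.exp_pos _), h.exp_Xi_real]
  calc _ ≤ 48 * (l * |θ|) ^ (-1 / 2 : ℝ) := key
    _ = 288 * (l / |θ|) ^ (1 / 2 : ℝ) * (1 / (6 * l)) := by
        rw [Real.mul_rpow hl.le hθ.le, Real.div_rpow hl.le hθ.le,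
          show (-1 / 2 : ℝ) = -(1 / 2) by norm_num, Real.rpow_neg hθ.le, Real.rpow_neg hl.le]
        have e : l ^ (1 / 2 : ℝ) * l ^ (1 / 2 : ℝ) = l := by
          rw [← Real.rpow_add hl]; norm_num
        have : 0 < l ^ (1 / 2 : ℝ) := by positivity
        have : 0 < |θ| ^ (1 / 2 : ℝ) := by positivity
        field_simp
        linear_combination -288 * e
    _ ≤ _ := by
        gcongr
        exact h.le_integral_real_zero_one

/-- A saving in the ratio that is quadratic in `θ/l` when `|θ|/l` is bounded. -/
theorem exp_re_sub_le_one_sub (h : KernelData a b l m θ) :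
    Real.exp ((Xi a b).re - (Xi (Real.exp (-l) : ℝ) (Real.exp (-m) : ℝ)).re) ≤
      1 - (|θ| / l) ^ 2 / (80 + 2 * (|θ| / l) ^ 2) / 192 := by
  have hl := h.l_pos
  have hl' := h.l_le
  set η := (|θ| / l) ^ 2 / (80 + 2 * (|θ| / l) ^ 2) with hη
  have hη0 : 0 ≤ η := by positivity
  have hη1 : 1 - 2 * η = 40 * l ^ 2 / (40 * l ^ 2 + θ ^ 2) := by
    rw [hη, div_pow, sq_abs]
    field_simp
    ring
  have hη2 : 0 ≤ 1 - 2 * η := by rw [hη1]; positivity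
  have hmem : 1 - l ∈ Set.Icc (0 : ℝ) 1 := ⟨by linarith, by linarith⟩
  have hpos : ∀ v ∈ Set.Icc (0 : ℝ) 1,
      0 < 1 - v * Real.exp (-l) ∧ 0 < 1 - v * Real.exp (-m) := by
    intro v hv
    have := h.weight_le hv
    constructor <;> linarith [hv.2]
  have hfac : ∀ v ∈ Set.Icc (0 : ℝ) 1,
      ‖1 - (v : ℂ) * b‖⁻¹ ≤ (1 - v * Real.exp (-m))⁻¹ := by
    intro v hv
    refine inv_anti₀ (hpos v hv).2 ?_
    rw [← h.norm_b]
    exact one_sub_mul_norm_le b hv.1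
  have hnorm := h.intervalIntegrable_norm
  have hsub : ∀ u w : ℝ, u ∈ Set.Icc (0 : ℝ) 1 → w ∈ Set.Icc (0 : ℝ) 1 → IntervalIntegrable
      (fun v : ℝ => ‖1 - (v : ℂ) * a‖⁻¹ * ‖1 - (v : ℂ) * b‖⁻¹) volume u w := by
    intro u w hu hw
    refine hnorm.mono_set ?_
    rw [Set.uIcc_of_le zero_le_one]
    exact Set.uIcc_subset_Icc hu hw
  have hleft : (∫ v in (0 : ℝ)..(1 - l), ‖1 - (v : ℂ) * a‖⁻¹ * ‖1 - (v : ℂ) * b‖⁻¹) ≤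
      ∫ v in (0 : ℝ)..(1 - l), (1 - v * Real.exp (-l))⁻¹ * (1 - v * Real.exp (-m))⁻¹ := by
    refine intervalIntegral.integral_mono_on hmem.1 (hsub _ _ ⟨le_rfl, by simp⟩ hmem)
      (h.intervalIntegrable_real ⟨le_rfl, by simp⟩ hmem) fun v hv => ?_
    have hv' : v ∈ Set.Icc (0 : ℝ) 1 := ⟨hv.1, hv.2.trans hmem.2⟩
    have hA := one_sub_mul_norm_le a hv'.1
    rw [h.norm_a] at hA
    exact mul_le_mul (inv_anti₀ (hpos v hv').1 hA) (hfac v hv') (by positivity)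
      (inv_nonneg.2 (hpos v hv').1.le)
  have hright : (∫ v in (1 - l)..1, ‖1 - (v : ℂ) * a‖⁻¹ * ‖1 - (v : ℂ) * b‖⁻¹) ≤
      (1 - η) * ∫ v in (1 - l)..1, (1 - v * Real.exp (-l))⁻¹ * (1 - v * Real.exp (-m))⁻¹ := by
    rw [← intervalIntegral.integral_const_mul]
    refine intervalIntegral.integral_mono_on hmem.2 (hsub _ _ hmem ⟨by simp, le_rfl⟩)
      ((h.intervalIntegrable_real hmem ⟨by simp, le_rfl⟩).const_mul _) fun v hv => ?_
    have hv' : v ∈ Set.Icc (0 : ℝ) 1 := ⟨hmem.1.trans hv.1, hv.2⟩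
    have hx := (hpos v hv').1
    have hx2 : 1 - v * Real.exp (-l) ≤ 2 * l := by
      linarith [one_sub_mul_exp_neg_le hl.le hv', hv.1]
    have hd : θ ^ 2 / 10 ≤ 2 * v * Real.exp (-l) * (1 - Real.cos θ) := by
      have hc := Real.cos_le_one_sub_mul_cos_sq (x := θ) (by linarith [h.abs_le, Real.pi_gt_three])
      have hpi : (1 : ℝ) / 5 ≤ 2 / π ^ 2 := by
        rw [div_le_div_iff₀ (by norm_num) (by positivity)]
        nlinarith [Real.pi_lt_d2, Real.pi_pos]
      have hc' : θ ^ 2 / 5 ≤ 1 - Real.cos θ := by nlinarith [sq_nonneg θ]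
      have he : (1 : ℝ) / 2 ≤ Real.exp (-l) := by linarith [Real.add_one_le_exp (-l)]
      have hv2 : (1 : ℝ) / 2 ≤ v := by linarith [hv.1]
      calc θ ^ 2 / 10 = 2 * (1 / 2) * (1 / 2) * (θ ^ 2 / 5) := by ring
        _ ≤ _ := by gcongr
    have hxa : 1 - v * Real.exp (-l) ≤ (1 - η) * ‖1 - (v : ℂ) * a‖ := by
      refine (pow_le_pow_iff_left₀ hx.le (mul_nonneg (by linarith) (norm_nonneg _))
        two_ne_zero).1 ?_
      rw [mul_pow, norm_one_sub_mul_sq h.norm_a h.re_a]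
      generalize 1 - v * Real.exp (-l) = x at *
      generalize 2 * v * Real.exp (-l) * (1 - Real.cos θ) = d at *
      have hd0 : 0 ≤ d := le_trans (by positivity) hd
      calc x ^ 2 ≤ (1 - 2 * η) * (x ^ 2 + d) := by
            rw [hη1, div_mul_eq_mul_div, le_div_iff₀ (by positivity)]
            have : x ^ 2 * θ ^ 2 ≤ (2 * l) ^ 2 * θ ^ 2 := by gcongr
            nlinarith [mul_le_mul_of_nonneg_left hd (sq_nonneg l)]
        _ ≤ (1 - η) ^ 2 * (x ^ 2 + d) := by
            gcongr
            nlinarith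
    have hna : 0 < ‖1 - (v : ℂ) * a‖ := norm_pos_iff.2 (one_sub_mul_ne_zero h.norm_a_lt hv')
    have hinv : ‖1 - (v : ℂ) * a‖⁻¹ ≤ (1 - η) * (1 - v * Real.exp (-l))⁻¹ := by
      rw [← div_eq_mul_inv, inv_eq_one_div, div_le_div_iff₀ hna hx]
      linarith
    rw [← mul_assoc]
    exact mul_le_mul hinv (hfac v hv') (by positivity)
      (mul_nonneg (by linarith) (inv_nonneg.2 hx.le))
  rw [Real.exp_sub, div_le_iff₀ (Real.exp_pos _), h.exp_Xi_real]
  refine h.norm_exp_Xi_le.trans ?_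
  rw [← intervalIntegral.integral_add_adjacent_intervals (hsub _ _ ⟨le_rfl, by simp⟩ hmem)
    (hsub _ _ hmem ⟨by simp, le_rfl⟩)]
  have hsplit := h.integral_split
  have hup := h.integral_real_le
  have hlo := h.le_integral_real
  set E := ∫ v in (0 : ℝ)..1, (1 - v * Real.exp (-l))⁻¹ * (1 - v * Real.exp (-m))⁻¹
  set F := ∫ v in (1 - l)..1, (1 - v * Real.exp (-l))⁻¹ * (1 - v * Real.exp (-m))⁻¹
  have hEF : E / 192 ≤ F := by
    refine le_trans ?_ hlo
    calc E / 192 ≤ 32 / l / 192 := by gcongr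
      _ = 1 / (6 * l) := by field_simp; norm_num
  nlinarith [mul_le_mul_of_nonneg_left hEF hη0]

/-- The saving at a single prime. -/
theorem re_sub_le (h : KernelData a b l m θ) :
    (Xi a b).re - (Xi (Real.exp (-l) : ℝ) (Real.exp (-m) : ℝ)).re ≤
      -(1 / (15360 * (1 + (288 ^ 4) ^ 2)) * Real.log (1 + (θ / l) ^ 2)) := by
  have hl := h.l_pos
  set D := (Xi a b).re - (Xi (Real.exp (-l) : ℝ) (Real.exp (-m) : ℝ)).re with hD
  rw [← sq_abs (θ / l), abs_div, abs_of_pos hl]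
  set R := |θ| / l with hR
  have hR0 : 0 ≤ R := by positivity
  have hlog0 : 0 ≤ Real.log (1 + R ^ 2) := Real.log_nonneg (by nlinarith)
  rcases le_total R (288 ^ 4) with hle | hge
  · have h1 := h.exp_re_sub_le_one_sub
    rw [← hD, ← hR] at h1
    have h2 := Real.add_one_le_exp D
    have h3 : Real.log (1 + R ^ 2) ≤ R ^ 2 := by
      linarith [Real.log_le_sub_one_of_pos (x := 1 + R ^ 2) (by positivity)]
    have h4 : R ^ 2 / (80 * (1 + (288 ^ 4) ^ 2)) ≤ R ^ 2 / (80 + 2 * R ^ 2) := by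
      have : R ^ 2 ≤ (288 ^ 4) ^ 2 := by gcongr
      gcongr
      linarith
    have h5 : 1 / (15360 * (1 + (288 ^ 4) ^ 2)) * Real.log (1 + R ^ 2) ≤
        R ^ 2 / (80 * (1 + (288 ^ 4) ^ 2)) / 192 := by
      calc _ ≤ 1 / (15360 * (1 + (288 ^ 4) ^ 2)) * R ^ 2 := by gcongr
        _ = _ := by ring
    linarith
  · have hRpos : 0 < R := lt_of_lt_of_le (by norm_num) hge
    have hθ0 : θ ≠ 0 := by
      rintro rfl
      simp [hR] at hRpos
    have h1 := h.exp_re_sub_le_sqrt hθ0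
    rw [← hD, ← inv_div, ← hR] at h1
    have h2 : D ≤ Real.log (288 * R⁻¹ ^ (1 / 2 : ℝ)) := by
      rw [Real.le_log_iff_exp_le (by positivity)]
      exact h1
    rw [Real.log_mul (by norm_num) (by positivity), Real.log_rpow (by positivity),
      Real.log_inv] at h2
    have h3 : 4 * Real.log 288 ≤ Real.log R := by
      have := Real.log_le_log (by norm_num) hge
      rwa [Real.log_pow] at this
    have h4 : Real.log (1 + R ^ 2) ≤ 4 * Real.log R := by
      have hpow := Real.log_pow R 4
      push_cast at hpow
      rw [← hpow]
      refine Real.log_le_log (by positivity) ?_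
      have : (2 : ℝ) ≤ R := le_trans (by norm_num) hge
      nlinarith [mul_le_mul this this (by norm_num) hR0]
    have h5 : 1 / (15360 * (1 + (288 ^ 4) ^ 2)) * Real.log (1 + R ^ 2) ≤
        1 / 16 * Real.log (1 + R ^ 2) := by
      gcongr
      norm_num
    linarith

end KernelData

theorem Xi_re_comm {a b : ℂ} (ha : ‖a‖ < 1) (hb : ‖b‖ < 1) : (Xi a b).re = (Xi b a).re := by
  apply Real.exp_injective
  rw [← Complex.norm_exp, ← Complex.norm_exp, exp_Xi_eq_integral ha hb, exp_Xi_eq_integral hb ha]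
  simp_rw [mul_comm]

theorem norm_natCast_cpow_neg {p : ℕ} (hp : 0 < p) (σ τ : ℝ) :
    ‖(p : ℂ) ^ (-((σ : ℂ) + (τ : ℂ) * Complex.I))‖ = Real.exp (-(σ * Real.log p)) := by
  rw [Complex.norm_natCast_cpow_of_pos hp, Real.rpow_def_of_pos (by exact_mod_cast hp)]
  congr 1
  simp
  ring

theorem natCast_cpow_neg_re {p : ℕ} (hp : 0 < p) (σ τ : ℝ) :
    ((p : ℂ) ^ (-((σ : ℂ) + (τ : ℂ) * Complex.I))).re =
      Real.exp (-(σ * Real.log p)) * Real.cos (τ * Real.log p) := by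
  rw [Complex.cpow_def_of_ne_zero (by exact_mod_cast hp.ne'), ← Complex.natCast_log,
    Complex.exp_re, ← Real.cos_neg (τ * Real.log p)]
  generalize Real.log p = L
  congr 2 <;> simp <;> ring

theorem natCast_cpow_neg_ofReal {p : ℕ} (hp : 0 < p) (σ : ℝ) :
    (p : ℂ) ^ (-(σ : ℂ)) = (Real.exp (-(σ * Real.log p)) : ℝ) := by
  rw [Complex.cpow_def_of_ne_zero (by exact_mod_cast hp.ne'), ← Complex.natCast_log]
  push_cast
  congr 1
  ring

theorem kernelData_natCast_cpow {p : ℕ} {y σ κ τ t : ℝ} (hp : p ∈ primesLe y) (hσ : 0 < σ)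
    (hκ : 0 < κ) (h1 : σ ≤ 2 * κ) (h2 : κ ≤ 2 * σ) (h3 : (σ + |τ|) * Real.log y ≤ 1 / 2)
    (h4 : (κ + |t|) * Real.log y ≤ 1 / 2) :
    KernelData ((p : ℂ) ^ (-((σ : ℂ) + (τ : ℂ) * Complex.I)))
      ((p : ℂ) ^ (-((κ : ℂ) + (t : ℂ) * Complex.I)))
      (σ * Real.log p) (κ * Real.log p) (τ * Real.log p) := by
  simp only [primesLe, Finset.mem_filter, Finset.mem_Iic] at hp
  have hp2 : (2 : ℝ) ≤ p := by exact_mod_cast hp.2.two_le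
  have hpos := hp.2.pos
  have hpy : (p : ℝ) ≤ y := (Nat.le_floor_iff' hpos.ne').1 hp.1
  have hL : 0 < Real.log p := Real.log_pos (by linarith)
  have hLy : Real.log p ≤ Real.log y := Real.log_le_log (by linarith) hpy
  have g1 : (σ + |τ|) * Real.log p ≤ 1 / 2 := le_trans (by gcongr) h3
  have g2 : (κ + |t|) * Real.log p ≤ 1 / 2 := le_trans (by gcongr) h4
  have n1 := mul_nonneg (abs_nonneg τ) hL.le
  have n2 := mul_nonneg (abs_nonneg t) hL.le
  have n3 := mul_pos hσ hL
  have n4 := mul_pos hκ hL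
  exact {
    l_pos := n3
    l_le := by linarith
    m_pos := n4
    m_le := by linarith
    l_le_m := by nlinarith
    m_le_l := by nlinarith
    abs_le := by rw [abs_mul, abs_of_pos hL]; linarith
    norm_a := norm_natCast_cpow_neg hpos σ τ
    norm_b := norm_natCast_cpow_neg hpos κ t
    re_a := natCast_cpow_neg_re hpos σ τ }

/-- The saving at a single prime, in terms of both imaginary parts. -/
theorem Xi_natCast_cpow_re_sub_le {p : ℕ} {y σ κ τ t : ℝ} (hp : p ∈ primesLe y) (hσ : 0 < σ)
    (hκ : 0 < κ) (h1 : σ ≤ 2 * κ) (h2 : κ ≤ 2 * σ) (h3 : (σ + |τ|) * Real.log y ≤ 1 / 2)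
    (h4 : (κ + |t|) * Real.log y ≤ 1 / 2) :
    (Xi ((p : ℂ) ^ (-((σ : ℂ) + (τ : ℂ) * Complex.I)))
        ((p : ℂ) ^ (-((κ : ℂ) + (t : ℂ) * Complex.I)))).re -
      (Xi ((p : ℂ) ^ (-(σ : ℂ))) ((p : ℂ) ^ (-(κ : ℂ)))).re ≤
      -(1 / (30720 * (1 + (288 ^ 4) ^ 2)) *
        (Real.log (1 + (τ / σ) ^ 2) + Real.log (1 + (t / κ) ^ 2))) := by
  have d1 := kernelData_natCast_cpow hp hσ hκ h1 h2 h3 h4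
  have d2 := kernelData_natCast_cpow hp hκ hσ h2 h1 h4 h3
  have hprime : p.Prime := (Finset.mem_filter.1 hp).2
  have hL : Real.log p ≠ 0 := (Real.log_pos (by exact_mod_cast hprime.one_lt)).ne'
  have e1 := d1.re_sub_le
  have e2 := d2.re_sub_le
  have n1 : ‖((Real.exp (-(σ * Real.log p)) : ℝ) : ℂ)‖ < 1 := by
    rw [Complex.norm_real, Real.norm_of_nonneg (Real.exp_pos _).le, ← d1.norm_a]
    exact d1.norm_a_lt
  have n2 : ‖((Real.exp (-(κ * Real.log p)) : ℝ) : ℂ)‖ < 1 := by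
    rw [Complex.norm_real, Real.norm_of_nonneg (Real.exp_pos _).le, ← d1.norm_b]
    exact d1.norm_b_lt
  rw [Xi_re_comm d1.norm_b_lt d1.norm_a_lt, Xi_re_comm n2 n1] at e2
  rw [mul_div_mul_right _ _ hL] at e1 e2
  rw [natCast_cpow_neg_ofReal hprime.pos, natCast_cpow_neg_ofReal hprime.pos]
  linarith only [e1, e2]

/-- Lemma 5.(i). -/
theorem stmt13 :
    ∃ c₁ > (0 : ℝ), ∀ y : ℝ, 2 ≤ y → ∀ σ κ τ t : ℝ, 0 < σ → 0 < κ →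
      |σ - κ| ≤ c₁ * σ → max (σ + |τ|) (κ + |t|) ≤ c₁ / Real.log y →
      (fy y ((σ : ℂ) + (τ : ℂ) * Complex.I) ((κ : ℂ) + (t : ℂ) * Complex.I) -
          fy y (σ : ℂ) (κ : ℂ)).re ≤
        -(c₁ * (y / Real.log y) *
          (Real.log (1 + (τ / σ) ^ 2) + Real.log (1 + (t / κ) ^ 2))) := by
  obtain ⟨c, hc⟩ : ∃ c : ℝ, c = 1 / (30720 * (1 + (288 ^ 4) ^ 2)) := ⟨_, rfl⟩
  have hc0 : 0 < c := by rw [hc]; positivity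
  have hc1 : c ≤ 1 := by rw [hc]; norm_num
  refine ⟨c / 10, by positivity, fun y hy σ κ τ t hσ hκ hσκ hmax => ?_⟩
  have hl : 0 < Real.log y := Real.log_pos (by linarith)
  have hdiff := abs_le.1 hσκ
  have hcσ : c / 10 * σ ≤ 1 / 10 * σ := by gcongr
  rw [max_le_iff, le_div_iff₀ hl, le_div_iff₀ hl] at hmax
  set S := Real.log (1 + (τ / σ) ^ 2) + Real.log (1 + (t / κ) ^ 2) with hS
  have hS0 : 0 ≤ S := add_nonneg (Real.log_nonneg (by nlinarith [sq_nonneg (τ / σ)]))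
    (Real.log_nonneg (by nlinarith [sq_nonneg (t / κ)]))
  rw [fy, fy, ← Finset.sum_sub_distrib, Complex.re_sum]
  have hterm := Finset.sum_le_card_nsmul (primesLe y)
    (fun p : ℕ => (Xi ((p : ℂ) ^ (-((σ : ℂ) + (τ : ℂ) * Complex.I)))
      ((p : ℂ) ^ (-((κ : ℂ) + (t : ℂ) * Complex.I))) -
      Xi ((p : ℂ) ^ (-(σ : ℂ))) ((p : ℂ) ^ (-(κ : ℂ)))).re) (-(c * S)) fun p hp => by
    rw [hc]
    exact Xi_natCast_cpow_re_sub_le hp hσ hκ (by linarith) (by linarith) (by linarith)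
      (by linarith)
  refine hterm.trans ?_
  rw [nsmul_eq_mul]
  have := mul_le_mul_of_nonneg_right (div_log_le_card_primesLe hy) (mul_nonneg hc0.le hS0)
  linarith

end
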